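/- arXiv:1002.3239 — 2 statements merged into one kernel-verified Lean document; each statement's English description precedes it below -/
import Mathlib

section
/- Let b be a vector of admissible and min-consistent beliefs for f with parameter vector c of nonzero reals, and suppose f can be written as a conical combination of the beliefs. If the beliefs admit a unique estimate x*, then x* is a global minimum of f: f(x*) ≤ f(x) for all x : Fin n → X. -/
/-- The fibrewise minimum of `b` over the points whose `i`-th coordinate is `t` is a lower bound
for `b` on that fibre. -/
theorem sInf_fibre_le {ι X : Type*} [Finite ι] [Finite X] (b : (ι → X) → ℝ) (i : ι)
    (x : ι → X) : sInf {r : ℝ | ∃ y : ι → X, y i = x i ∧ b y = r} ≤ b x :=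
  csInf_le ((Set.finite_range b).subset (by rintro _ ⟨y, -, rfl⟩; exact ⟨y, rfl⟩)).bddBelow
    ⟨x, rfl, rfl⟩

/-- A lower bound of `b` is a lower bound of its fibrewise minima. -/
theorem le_sInf_fibre {ι X : Type*} (b : (ι → X) → ℝ) (i : ι)
    (t : X) {m : ℝ} (hm : ∀ y, m ≤ b y) :
    m ≤ sInf {r : ℝ | ∃ y : ι → X, y i = t ∧ b y = r} :=
  le_csInf ⟨_, fun _ => t, rfl, rfl⟩ (by rintro _ ⟨y, -, rfl⟩; exact hm y)

/-- If the min-marginals of `b` agree, up to constants, with functions `bv i` that are uniquely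
minimized at `xs i`, then `xs` minimizes `b`. -/
theorem le_of_minConsistent {ι X : Type*} [Finite ι] [Finite X] [Nonempty X]
    {α : Finset ι} {b : (ι → X) → ℝ} {bv : ι → X → ℝ} {xs : ι → X}
    (hdep : ∀ x y : ι → X, (∀ i ∈ α, x i = y i) → b x = b y)
    (hmc : ∀ i ∈ α, ∃ κ : ℝ, ∀ t : X,
      sInf {r : ℝ | ∃ x : ι → X, x i = t ∧ b x = r} = κ + bv i t)
    (hxs : ∀ i, ∀ y : X, y ≠ xs i → bv i (xs i) < bv i y) (x : ι → X) : b xs ≤ b x := by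
  obtain ⟨z, hz⟩ := Finite.exists_min b
  have hzxs : ∀ i ∈ α, xs i = z i := by
    intro i hi
    obtain ⟨κ, hκ⟩ := hmc i hi
    by_contra hne
    have hlt := hxs i (z i) (Ne.symm hne)
    have h₁ := le_sInf_fibre b i (xs i) hz
    have h₂ := sInf_fibre_le b i z
    rw [hκ] at h₁ h₂
    linarith
  exact (hdep xs z hzxs).trans_le (hz x)

/-- Under the hypotheses of `le_of_minConsistent`, `xs` also minimizes `b x - bv i (x i)` for `i ∈ α`. -/
theorem sub_le_sub_of_minConsistent {ι X : Type*} [Finite ι] [Finite X]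
    {b : (ι → X) → ℝ} {bi : X → ℝ} {xs : ι → X} {i : ι}
    (hmc : ∃ κ : ℝ, ∀ t : X, sInf {r : ℝ | ∃ x : ι → X, x i = t ∧ b x = r} = κ + bi t)
    (hmin : ∀ x, b xs ≤ b x) (x : ι → X) : b xs - bi (xs i) ≤ b x - bi (x i) := by
  obtain ⟨κ, hκ⟩ := hmc
  have h₁ := le_sInf_fibre b i (xs i) hmin
  have h₂ := sInf_fibre_le b i x
  rw [hκ] at h₁ h₂
  linarith

/-- If the beliefs are admissible and min-consistent for `f`, `f`
can be written as a conical combination of the beliefs, and the beliefs admit a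
unique estimate `x*`, then `x*` is a global minimum of `f`. -/
theorem unique_estimate_global_minimum_of_conical
    {X : Type} [Fintype X] [Nonempty X] {n : ℕ}
    (A : Finset (Finset (Fin n))) (hAne : ∀ α ∈ A, α.Nonempty)
    (φ : Fin n → X → ℝ) (ψ : Finset (Fin n) → (Fin n → X) → ℝ)
    (hψ : ∀ α ∈ A, ∀ x y : Fin n → X, (∀ i ∈ α, x i = y i) → ψ α x = ψ α y)
    (f : (Fin n → X) → ℝ)
    (hf : ∀ x, f x = ∑ i, φ i (x i) + ∑ α ∈ A, ψ α x)
    (cv : Fin n → ℝ) (cf : Finset (Fin n) → ℝ)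
    (hcv : ∀ i, cv i ≠ 0) (hcf : ∀ α ∈ A, cf α ≠ 0)
    (bv : Fin n → X → ℝ) (bf : Finset (Fin n) → (Fin n → X) → ℝ)
    (hbfdep : ∀ α ∈ A, ∀ x y : Fin n → X, (∀ i ∈ α, x i = y i) → bf α x = bf α y)
    -- admissibility:
    (κ : ℝ)
    (hadm : ∀ x : Fin n → X, f x = κ + ∑ i, cv i * bv i (x i) +
      ∑ α ∈ A, cf α * (bf α x - ∑ k ∈ α, cv k * bv k (x k)))
    -- min-consistency:
    (hmc : ∀ α ∈ A, ∀ i ∈ α, ∃ κ' : ℝ, ∀ t : X,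
      sInf {r : ℝ | ∃ x : Fin n → X, x i = t ∧ bf α x = r} = κ' + bv i t)
    -- `f` is a conical combination of the beliefs:
    (dvv : Fin n → ℝ) (dff : Finset (Fin n) → ℝ) (dvf : Fin n → Finset (Fin n) → ℝ)
    (hdvv : ∀ i, 0 ≤ dvv i) (hdff : ∀ α ∈ A, 0 ≤ dff α)
    (hdvf : ∀ α ∈ A, ∀ i ∈ α, 0 ≤ dvf i α)
    (κd : ℝ)
    (hcon : ∀ x : Fin n → X, f x = κd +
      ∑ α ∈ A, ∑ i ∈ α, dvf i α * (bf α x - bv i (x i)) +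
      ∑ α ∈ A, dff α * bf α x + ∑ i, dvv i * bv i (x i))
    -- `xs` is a unique estimate for the beliefs:
    (xs : Fin n → X)
    (hxs : ∀ i : Fin n, ∀ y : X, y ≠ xs i → bv i (xs i) < bv i y) :
    ∀ x : Fin n → X, f xs ≤ f x := by
  intro x
  have hbf : ∀ α ∈ A, ∀ y, bf α xs ≤ bf α y := fun α hα =>
    le_of_minConsistent (hbfdep α hα) (hmc α hα) hxs
  have hbv : ∀ i, bv i (xs i) ≤ bv i (x i) := by
    intro i
    rcases eq_or_ne (x i) (xs i) with h | h
    · rw [h]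
    · exact (hxs i _ h).le
  rw [hcon xs, hcon x]
  refine add_le_add (add_le_add (add_le_add le_rfl ?_) ?_) ?_
  · exact Finset.sum_le_sum fun α hα => Finset.sum_le_sum fun i hi =>
      mul_le_mul_of_nonneg_left (sub_le_sub_of_minConsistent (hmc α hα i hi) (hbf α hα) x)
        (hdvf α hα i hi)
  · exact Finset.sum_le_sum fun α hα => mul_le_mul_of_nonneg_left (hbf α hα x) (hdff α hα)
  · exact Finset.sum_le_sum fun i _ => mul_le_mul_of_nonneg_left (hbv i) (hdvv i)
end

section
/- Let b be a vector of beliefs admissible for f with parameter vector c of nonzero reals, with admissibility constant κ, and suppose c_α ≥ 0 for every factor α and c_i·(1 − ∑_{α∈∂i} c_α) ≥ 0 for every variable i. Then the minimum of f is bounded below by the lower bound: min_x f(x) ≥ κ + ∑_i c_i·(1 − ∑_{α∈∂i} c_α)·(min_{x_i∈X} b_i(x_i)) + ∑_α c_α·(min_x b_α(x)). -/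
/-- Exchanging the order of summation over the incidences between variables and factors. -/
theorem sum_mul_sum_mem_eq_sum_sum_filter_mul {ι R : Type*} [Fintype ι] [DecidableEq ι]
    [CommSemiring R] (A : Finset (Finset ι)) (w : Finset ι → R) (g : ι → R) :
    ∑ α ∈ A, w α * ∑ k ∈ α, g k = ∑ i, (∑ α ∈ A with i ∈ α, w α) * g i := by
  simp_rw [Finset.mul_sum, Finset.sum_mul]
  exact Finset.sum_comm' (by simp [and_comm])

theorem sInf_range_le_of_finite {Y : Type*} [Finite Y] (g : Y → ℝ) (y : Y) :
    sInf (Set.range g) ≤ g y :=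
  csInf_le (Set.finite_range g).bddBelow (Set.mem_range_self y)

/-- If the beliefs are admissible for `f` with constant `κ` and
the parameters satisfy `c_α ≥ 0` for every factor and
`c_i·(1 − ∑_{α∈∂i} c_α) ≥ 0` for every variable, then the minimum of `f` is
bounded below by the lower bound `LB`. -/
theorem admissible_beliefs_lower_bound
    {X : Type} [Fintype X] [Nonempty X] {n : ℕ}
    (A : Finset (Finset (Fin n))) (hAne : ∀ α ∈ A, α.Nonempty)
    (φ : Fin n → X → ℝ) (ψ : Finset (Fin n) → (Fin n → X) → ℝ)
    (hψ : ∀ α ∈ A, ∀ x y : Fin n → X, (∀ i ∈ α, x i = y i) → ψ α x = ψ α y)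
    (f : (Fin n → X) → ℝ)
    (hf : ∀ x, f x = ∑ i, φ i (x i) + ∑ α ∈ A, ψ α x)
    (cv : Fin n → ℝ) (cf : Finset (Fin n) → ℝ)
    (hcv : ∀ i, cv i ≠ 0) (hcf : ∀ α ∈ A, cf α ≠ 0)
    (hcond1 : ∀ α ∈ A, 0 ≤ cf α)
    (hcond2 : ∀ i : Fin n,
      0 ≤ cv i * (1 - ∑ α ∈ A.filter (fun α => i ∈ α), cf α))
    (bv : Fin n → X → ℝ) (bf : Finset (Fin n) → (Fin n → X) → ℝ)
    (hbfdep : ∀ α ∈ A, ∀ x y : Fin n → X, (∀ i ∈ α, x i = y i) → bf α x = bf α y)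
    -- admissibility with constant κ:
    (κ : ℝ)
    (hadm : ∀ x : Fin n → X, f x = κ + ∑ i, cv i * bv i (x i) +
      ∑ α ∈ A, cf α * (bf α x - ∑ k ∈ α, cv k * bv k (x k))) :
    κ + ∑ i, cv i * (1 - ∑ α ∈ A.filter (fun α => i ∈ α), cf α) *
          sInf (Set.range (bv i)) +
        ∑ α ∈ A, cf α * sInf (Set.range (bf α)) ≤
      sInf (Set.range f) := by
  refine le_csInf (Set.range_nonempty f) ?_
  rintro _ ⟨x, rfl⟩
  have hreparam : f x = κ +
      ∑ i, cv i * (1 - ∑ α ∈ A.filter (fun α => i ∈ α), cf α) * bv i (x i) +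
      ∑ α ∈ A, cf α * bf α x := by
    have hswap := sum_mul_sum_mem_eq_sum_sum_filter_mul A cf (fun k => cv k * bv k (x k))
    have hsplit : ∑ i, cv i * (1 - ∑ α ∈ A.filter (fun α => i ∈ α), cf α) * bv i (x i) =
        ∑ i, cv i * bv i (x i) -
          ∑ i, (∑ α ∈ A.filter (fun α => i ∈ α), cf α) * (cv i * bv i (x i)) := by
      rw [← Finset.sum_sub_distrib]
      exact Finset.sum_congr rfl fun i _ => by ring
    rw [hadm x, hsplit, ← hswap]
    simp_rw [mul_sub, Finset.sum_sub_distrib]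
    ring
  rw [hreparam]
  gcongr with i _ α hα
  · exact hcond2 i
  · exact sInf_range_le_of_finite (bv i) (x i)
  · exact hcond1 α hα
  · exact sInf_range_le_of_finite (bf α) x
end
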